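/- Let G be the complete graph on n vertices, and let a, b, n', m, Δ be non-negative integers with b − Δ ≥ a ≥ 2 and n > (a+b)(a+b+2m−2)/(a+Δ) + n'. Let g, f be integer-valued functions on V(G) with a ≤ g(x) ≤ f(x) − Δ ≤ b − Δ for every vertex x. Then G is a fractional (g,f,n',m)-critical deleted graph. -/

import Mathlib

open Classical Finset

/-- The fractional degree `d_G^h(x)` of a vertex: the sum of `h e` over all edges
(unordered pairs) containing `x`. -/
noncomputable def fracDeg {V : Type*} [Fintype V] [DecidableEq V]
    (h : Sym2 V → ℝ) (x : V) : ℝ :=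
  ∑ e ∈ Finset.univ.filter (fun e : Sym2 V => x ∈ e), h e

/-- `G` admits a fractional `(g,f)`-factor: a weighting `h : E(G) → [0,1]`
(extended by `0` off the edge set) with `g x ≤ d_G^h(x) ≤ f x` for every vertex. -/
def HasFracFactor {V : Type*} [Fintype V] [DecidableEq V]
    (G : SimpleGraph V) (g f : V → ℤ) : Prop :=
  ∃ h : Sym2 V → ℝ,
    (∀ e, 0 ≤ h e ∧ h e ≤ 1) ∧
    (∀ e, e ∉ G.edgeSet → h e = 0) ∧
    (∀ x : V, (g x : ℝ) ≤ fracDeg h x ∧ fracDeg h x ≤ (f x : ℝ))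

/-- `G` is a fractional `(g,f,m)`-deleted graph: after deleting any `m` edges,
the resulting graph admits a fractional `(g,f)`-factor. -/
def FracDeleted {V : Type*} [Fintype V] [DecidableEq V]
    (G : SimpleGraph V) (g f : V → ℤ) (m : ℕ) : Prop :=
  ∀ H : Finset (Sym2 V), ↑H ⊆ G.edgeSet → H.card = m →
    HasFracFactor (G.deleteEdges ↑H) g f

/-- `G` is a fractional `(g,f,n',m)`-critical deleted graph: after deleting any `n'`
vertices, the resulting induced graph is a fractional `(g,f,m)`-deleted graph. -/
def FracCriticalDeleted {V : Type*} [Fintype V] [DecidableEq V]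
    (G : SimpleGraph V) (g f : V → ℤ) (n' m : ℕ) : Prop :=
  ∀ U : Finset V, U.card = n' →
    FracDeleted (G.induce ((↑U : Set V)ᶜ)) (fun x => g x.1) (fun x => f x.1) m

/-- `G` is a fractional ID-`(g,f,m)`-deleted graph: after deleting any independent set
of vertices, the resulting induced graph is a fractional `(g,f,m)`-deleted graph. -/
def FracIDDeleted {V : Type*} [Fintype V] [DecidableEq V]
    (G : SimpleGraph V) (g f : V → ℤ) (m : ℕ) : Prop :=
  ∀ I : Set V, (∀ u ∈ I, ∀ v ∈ I, ¬ G.Adj u v) →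
    FracDeleted (G.induce Iᶜ) (fun x => g x.1) (fun x => f x.1) m

theorem fracDeg_eq_sum {W : Type*} [Fintype W] [DecidableEq W] (h : Sym2 W → ℝ) (x : W) :
    fracDeg h x = ∑ v, h s(x, v) := by
  unfold fracDeg
  symm
  refine Finset.sum_bij (fun v _ => s(x, v)) ?_ ?_ ?_ ?_
  · intro v _
    simp
  · intro v _ w _ hvw
    exact Sym2.congr_right.1 hvw
  · intro e he
    obtain ⟨v, rfl⟩ := (Finset.mem_filter.1 he).2
    exact ⟨v, Finset.mem_univ _, rfl⟩
  · intro v _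
    rfl

/-- The dual form of the cut condition: a weighting `y` of the vertices is decomposed into
signed indicator functions of pairs `(T, S)` of disjoint vertex sets. -/
theorem sum_posPart_le_of_cut {W : Type*} [Fintype W] [DecidableEq W] (G : SimpleGraph W) (g f : W → ℝ)
    (hcut : ∀ S T : Finset W, Disjoint S T →
      ∑ x ∈ T, g x ≤ ∑ x ∈ S, f x + ∑ x ∈ T, (#{v | v ∉ S ∧ G.Adj x v} : ℝ)) (y : W → ℝ) :
    ∑ x, (g x * max (y x) 0 - f x * max (-y x) 0) ≤
      (∑ x, ∑ v, if G.Adj x v then max (y x + y v) 0 else 0) / 2 := by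
  induction hk : #{x | y x ≠ 0} using Nat.strong_induction_on generalizing y with
  | _ k ih =>
  rcases (Finset.univ.filter fun x => y x ≠ 0).eq_empty_or_nonempty with h0 | hne
  · have hy : ∀ x, y x = 0 := by simpa [Finset.filter_eq_empty_iff] using h0
    simp [hy]
  obtain ⟨x₀, hx₀, hmin⟩ := Finset.exists_min_image _ (fun x => |y x|) hne
  replace hx₀ : y x₀ ≠ 0 := by simpa using hx₀
  replace hmin : ∀ x, y x ≠ 0 → |y x₀| ≤ |y x| := fun x hx => hmin x (by simpa using hx)
  obtain ⟨δ, hδ⟩ : ∃ δ, δ = |y x₀| := ⟨_, rfl⟩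
  have hδpos : 0 < δ := hδ ▸ abs_pos.2 hx₀
  have hpos : ∀ x, 0 < y x → δ ≤ y x := fun x hx => by
    have := hmin x hx.ne'
    rwa [← hδ, abs_of_pos hx] at this
  have hneg : ∀ x, y x < 0 → δ ≤ -y x := fun x hx => by
    have := hmin x hx.ne
    rwa [← hδ, abs_of_neg hx] at this
  let z : W → ℝ := fun x => if 0 < y x then y x - δ else if y x < 0 then y x + δ else 0
  have hz : ∀ x, z x = if 0 < y x then y x - δ else if y x < 0 then y x + δ else 0 :=
    fun _ => rfl
  have hcard : #{x | z x ≠ 0} < k := by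
    rw [← hk]
    refine Finset.card_lt_card (Finset.ssubset_iff_subset_ne.2 ⟨?_, ?_⟩)
    · intro x hx
      simp only [Finset.mem_filter, Finset.mem_univ, true_and] at hx ⊢
      intro h
      exact hx (by simp [hz, h])
    · intro h
      have hmem : x₀ ∈ Finset.univ.filter (fun x => z x ≠ 0) := by rw [h]; simpa using hx₀
      simp only [Finset.mem_filter, Finset.mem_univ, true_and] at hmem
      apply hmem
      rw [hz]
      rcases lt_or_gt_of_ne hx₀ with h | h
      · rw [abs_of_neg h] at hδ
        simp [h, h.le, hδ]
      · rw [abs_of_pos h] at hδ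
        simp [h, hδ]
  have hrec := ih _ hcard z rfl
  let T : Finset W := Finset.univ.filter fun x => 0 < y x
  let S : Finset W := Finset.univ.filter fun x => y x < 0
  have hdisj : Disjoint S T := by
    rw [Finset.disjoint_left]
    intro x hxS hxT
    simp only [S, T, Finset.mem_filter, Finset.mem_univ, true_and] at hxS hxT
    linarith
  have hST := hcut S T hdisj
  have hvertex : ∀ x, g x * max (y x) 0 - f x * max (-y x) 0 =
      (g x * max (z x) 0 - f x * max (-z x) 0) +
        δ * ((if 0 < y x then g x else 0) - (if y x < 0 then f x else 0)) := by
    intro x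
    rw [hz]
    rcases lt_trichotomy (y x) 0 with h | h | h
    · have := hneg x h
      rw [if_neg h.le.not_gt, if_pos h, if_neg h.le.not_gt, if_pos h,
        max_eq_right h.le, max_eq_left (by linarith), max_eq_right (by linarith),
        max_eq_left (by linarith)]
      ring
    · simp [h]
    · have := hpos x h
      rw [if_pos h, if_pos h, if_neg h.le.not_gt, max_eq_left h.le,
        max_eq_right (by linarith), max_eq_left (by linarith), max_eq_right (by linarith)]
      ring
  let c : W → W → ℝ := fun x v => if G.Adj x v ∧ 0 < y x ∧ ¬ y v < 0 then 1 else 0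
  have hedge : ∀ x v, (if G.Adj x v then max (y x + y v) 0 else 0) =
      (if G.Adj x v then max (z x + z v) 0 else 0) + δ * (c x v + c v x) := by
    intro x v
    by_cases hxv : G.Adj x v
    · have hvx := hxv.symm
      simp only [c, hxv, hvx, true_and, if_true, hz]
      rcases lt_trichotomy (y x) 0 with h | h | h <;>
      rcases lt_trichotomy (y v) 0 with h' | h' | h'
      all_goals
        first
        | have h1 := hpos x h
        | have h1 := hneg x h
        | have h1 := h
        first
        | have h2 := hpos v h'
        | have h2 := hneg v h'
        | have h2 := h'
        simp only [h, h', h.not_gt, h'.not_gt, lt_irrefl, if_true, if_false, not_true,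
          not_false_eq_true, and_true, and_false]
        try grind
    · have hvx : ¬ G.Adj v x := fun h => hxv h.symm
      simp [c, hxv, hvx]
  have hc : ∑ x, ∑ v, c x v = ∑ x ∈ T, (#{v | v ∉ S ∧ G.Adj x v} : ℝ) := by
    rw [Finset.sum_filter]
    refine Finset.sum_congr rfl fun x _ => ?_
    by_cases hx : 0 < y x
    · simp only [c, hx, S, if_true, true_and, Finset.mem_filter, Finset.mem_univ,
        Finset.card_filter]
      push_cast
      exact Finset.sum_congr rfl fun v _ => by simp only [and_comm]
    · simp [c, hx]
  have hc' : ∑ x, ∑ v, c v x = ∑ x, ∑ v, c x v := Finset.sum_comm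
  simp only [hvertex, hedge, Finset.sum_add_distrib, ← Finset.mul_sum, Finset.sum_sub_distrib,
    hc', hc, ← Finset.sum_filter] at hrec ⊢
  have := mul_le_mul_of_nonneg_left hST hδpos.le
  simp only [T, S] at this ⊢
  linarith

/-- Sufficiency of the cut condition for the existence of a fractional `(g,f)`-factor. -/
theorem hasFracFactor_of_cut {W : Type*} [Fintype W] [DecidableEq W] (G : SimpleGraph W)
    (g f : W → ℤ) (hgf : ∀ x, g x ≤ f x)
    (hcut : ∀ S T : Finset W, Disjoint S T →
      ∑ x ∈ T, (g x : ℝ) ≤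
        ∑ x ∈ S, (f x : ℝ) + ∑ x ∈ T, (#{v | v ∉ S ∧ G.Adj x v} : ℝ)) :
    HasFracFactor G g f := by
  let D : (Sym2 W → ℝ) →ₗ[ℝ] (W → ℝ) :=
    { toFun := fun h x => ∑ v, h s(x, v)
      map_add' := fun h k => by ext x; simp [Finset.sum_add_distrib]
      map_smul' := fun r h => by ext x; simp [Finset.mul_sum] }
  let u : Sym2 W → ℝ := fun e => if e ∈ G.edgeSet then 1 else 0
  let K : Set (W → ℝ) := D '' Set.Icc 0 u
  let B : Set (W → ℝ) := Set.Icc (fun x => (g x : ℝ)) (fun x => (f x : ℝ))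
  suffices hKB : ¬ Disjoint K B by
    obtain ⟨_, ⟨h, ⟨h0, hu⟩, rfl⟩, hB⟩ := Set.not_disjoint_iff.1 hKB
    refine ⟨h, fun e => ⟨h0 e, (hu e).trans ?_⟩, fun e he => le_antisymm ?_ (h0 e), fun x => ?_⟩
    · by_cases he : e ∈ G.edgeSet <;> simp [u, he]
    · simpa [u, he] using hu e
    · rw [fracDeg_eq_sum]
      exact ⟨hB.1 x, hB.2 x⟩
  intro hdisj
  have hK : IsCompact K := isCompact_Icc.image D.continuous_of_finiteDimensional
  obtain ⟨φ, r, s, hφr, hrs, hφs⟩ := geometric_hahn_banach_compact_closed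
    ((convex_Icc (𝕜 := ℝ) _ _).linear_image D) hK (convex_Icc (𝕜 := ℝ) _ _) isClosed_Icc hdisj
  let y : W → ℝ := fun x => φ (Pi.single x 1)
  have hφ : ∀ w, φ w = ∑ x, y x * w x := by
    intro w
    conv_lhs => rw [pi_eq_sum_univ' w, map_sum]
    refine Finset.sum_congr rfl fun x _ => ?_
    rw [map_smul, smul_eq_mul, mul_comm]
  let h : Sym2 W → ℝ := fun e =>
    if e ∈ G.edgeSet ∧ 0 < (e.map y).lift ⟨fun p q => p + q, add_comm⟩ then 1 else 0
  have hh : ∀ x v, h s(x, v) = if G.Adj x v ∧ 0 < y x + y v then 1 else 0 := fun x v => rfl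
  have hhK : D h ∈ K := by
    refine ⟨h, ⟨fun e => ?_, fun e => ?_⟩, rfl⟩
    · simp only [h, Pi.zero_apply]
      split_ifs <;> norm_num
    · simp only [h, u]
      split_ifs <;> simp_all
  let z : W → ℝ := fun x => if 0 < y x then g x else f x
  have hzB : z ∈ B := by
    have hgf' : ∀ x, (g x : ℝ) ≤ f x := fun x => by exact_mod_cast hgf x
    refine ⟨fun x => ?_, fun x => ?_⟩ <;> simp only [z] <;> split_ifs <;> simp [hgf' x]
  have hlt : φ (D h) < φ z := (hφr _ hhK).trans (hrs.trans (hφs _ hzB))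
  have hz : φ z = ∑ x, ((g x : ℝ) * max (y x) 0 - f x * max (-y x) 0) := by
    rw [hφ]
    refine Finset.sum_congr rfl fun x _ => ?_
    simp only [z]
    split_ifs with hx
    · rw [max_eq_left hx.le, max_eq_right (by linarith)]
      ring
    · rw [max_eq_right (by linarith), max_eq_left (by linarith)]
      ring
  have hDh : φ (D h) = (∑ x, ∑ v, if G.Adj x v then max (y x + y v) 0 else 0) / 2 := by
    have h1 : φ (D h) = ∑ x, ∑ v, y x * h s(x, v) := by
      rw [hφ]
      exact Finset.sum_congr rfl fun x _ => Finset.mul_sum _ _ _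
    have h2 : φ (D h) = ∑ x, ∑ v, y v * h s(x, v) := by
      rw [h1, Finset.sum_comm]
      simp only [Sym2.eq_swap]
    have h3 : φ (D h) + φ (D h) = ∑ x, ∑ v, if G.Adj x v then max (y x + y v) 0 else 0 := by
      nth_rewrite 1 [h1]
      rw [h2, ← Finset.sum_add_distrib]
      refine Finset.sum_congr rfl fun x _ => ?_
      rw [← Finset.sum_add_distrib]
      refine Finset.sum_congr rfl fun v _ => ?_
      rw [hh]
      by_cases hxv : G.Adj x v
      · by_cases hy : 0 < y x + y v
        · simp [hxv, hy, hy.le]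
        · simp [hxv, hy, not_lt.1 hy]
      · simp [hxv]
    linarith
  have := sum_posPart_le_of_cut G (fun x => (g x : ℝ)) (fun x => (f x : ℝ)) hcut y
  linarith

theorem card_incident_le {W : Type*} [Fintype W] [DecidableEq W] (H : Finset (Sym2 W)) (x : W) :
    #{v | s(x, v) ∈ H} ≤ #H := by
  refine Finset.card_le_card_of_injOn (fun v => s(x, v)) (fun v hv => by simpa using hv) ?_
  intro v _ w _ hvw
  exact Sym2.congr_right.1 hvw

theorem sum_card_incident_le {W : Type*} [Fintype W] [DecidableEq W] (H : Finset (Sym2 W)) (T : Finset W) :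
    ∑ x ∈ T, #{v | s(x, v) ∈ H} ≤ 2 * #H := by
  have hle : ∀ e : Sym2 W, #{x | x ∈ e} ≤ 2 := by
    intro e
    induction e with
    | _ p q =>
      calc #{x | x ∈ s(p, q)} ≤ #{p, q} := Finset.card_le_card fun x hx => by simpa using hx
        _ ≤ 2 := Finset.card_le_two
  have hx : ∀ x : W, #{v | s(x, v) ∈ H} ≤ #{e ∈ H | x ∈ e} := by
    intro x
    refine Finset.card_le_card_of_injOn (fun v => s(x, v)) (fun v hv => by simpa using hv) ?_
    intro v _ w _ hvw
    exact Sym2.congr_right.1 hvw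
  calc ∑ x ∈ T, #{v | s(x, v) ∈ H} ≤ ∑ x ∈ T, #{e ∈ H | x ∈ e} :=
        Finset.sum_le_sum fun x _ => hx x
    _ ≤ ∑ x, #{e ∈ H | x ∈ e} := Finset.sum_le_sum_of_subset (Finset.subset_univ T)
    _ = ∑ e ∈ H, #{x | x ∈ e} := Finset.sum_card_bipartiteAbove_eq_sum_card_bipartiteBelow _
    _ ≤ ∑ _e ∈ H, 2 := Finset.sum_le_sum fun e _ => hle e
    _ = 2 * #H := by simp [mul_comm]

/-- The numerical core of the cut condition in a complete graph on `N` vertices with `m` edges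
removed: `s` and `t` are the sizes of the two sides and `l` counts the removed incidences. -/
theorem cut_arith {A B N m s t l : ℤ} (hA : 2 ≤ A) (hB : 2 ≤ B) (hm : 0 ≤ m) (hs : 0 ≤ s)
    (ht : 0 ≤ t) (hst : s + t ≤ N) (hl : l ≤ 2 * m) (hlt : l ≤ t * m)
    (hN : (A + B) * (A + B + 2 * m - 2) < A * N) :
    B * t ≤ A * s + (t * (N - 1 - s) - l) := by
  have hN' : A + B + 2 * m - 1 ≤ N := by
    by_contra! h
    nlinarith [mul_nonneg (by linarith : 0 ≤ B) (by linarith : 0 ≤ A + B + 2 * m - 2)]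
  have hAs : 2 * s ≤ A * s := mul_le_mul_of_nonneg_right hA hs
  rcases (by omega : t = 0 ∨ t = 1 ∨ 2 ≤ t) with rfl | rfl | h2
  · linarith
  · linarith
  by_cases hk : B ≤ N - 1 - s
  · nlinarith [mul_nonneg (by linarith : 0 ≤ t - 2) (by linarith : 0 ≤ N - 1 - s - B)]
  · push Not at hk
    obtain ⟨k, rfl⟩ : ∃ k, s = N - 1 - k := ⟨N - 1 - s, by ring⟩
    have hk0 : 0 ≤ k := by linarith
    have hkB : k + 1 ≤ B := by linarith
    have h1 : t * (B - k) ≤ (k + 1) * (B - k) :=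
      mul_le_mul_of_nonneg_right (by linarith) (by linarith)
    have h2 : 0 ≤ (A + B) * (A + B - 3 - k) := mul_nonneg (by linarith) (by linarith)
    have h3 : 0 ≤ k * (k + 1) := mul_nonneg hk0 (by linarith)
    have h4 : 0 ≤ (A + B - 1) * m := mul_nonneg (by linarith) hm
    nlinarith

/-- A complete graph on sufficiently many vertices is a fractional `(g,f,m)`-deleted graph. -/
theorem fracDeleted_top {W : Type*} [Fintype W] [DecidableEq W] {A B : ℤ} {m : ℕ} {g f : W → ℤ}
    (hA : 2 ≤ A) (hB : 2 ≤ B) (hgB : ∀ x, g x ≤ B) (hfA : ∀ x, A ≤ f x) (hgf : ∀ x, g x ≤ f x)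
    (hN : (A + B) * (A + B + 2 * m - 2) < A * (Fintype.card W : ℤ)) :
    FracDeleted (⊤ : SimpleGraph W) g f m := by
  intro H _ hm
  refine hasFracFactor_of_cut _ g f hgf fun S T hST => ?_
  have hdeg : ∀ x ∈ T, (Fintype.card W : ℤ) - 1 - #S - #{v | s(x, v) ∈ H} ≤
      #{v | v ∉ S ∧ ((⊤ : SimpleGraph W).deleteEdges ↑H).Adj x v} := by
    intro x _
    have hcover : (Finset.univ : Finset W) ⊆ S ∪ {x} ∪ ({v | s(x, v) ∈ H} : Finset W) ∪
        ({v | v ∉ S ∧ ((⊤ : SimpleGraph W).deleteEdges ↑H).Adj x v} : Finset W) := by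
      intro v _
      simp only [Finset.mem_union, Finset.mem_filter, Finset.mem_univ, true_and,
        Finset.mem_singleton, SimpleGraph.deleteEdges_adj, SimpleGraph.top_adj, Finset.mem_coe]
      tauto
    have h0 := Finset.card_le_card hcover
    have h1 := Finset.card_union_le (S ∪ {x} ∪ ({v | s(x, v) ∈ H} : Finset W))
      ({v | v ∉ S ∧ ((⊤ : SimpleGraph W).deleteEdges ↑H).Adj x v} : Finset W)
    have h2 := Finset.card_union_le (S ∪ {x}) ({v | s(x, v) ∈ H} : Finset W)
    have h3 := Finset.card_union_le S {x}
    rw [Finset.card_singleton] at h3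
    rw [Finset.card_univ] at h0
    omega
  have hsum := Finset.sum_le_sum hdeg
  rw [Finset.sum_sub_distrib, Finset.sum_const, nsmul_eq_mul] at hsum
  have hl : ∑ x ∈ T, (#{v | s(x, v) ∈ H} : ℤ) ≤ 2 * m := by
    rw [← hm]
    exact_mod_cast sum_card_incident_le H T
  have hlt : ∑ x ∈ T, (#{v | s(x, v) ∈ H} : ℤ) ≤ #T * m := by
    rw [← nsmul_eq_mul]
    refine Finset.sum_le_card_nsmul _ _ _ fun x _ => ?_
    rw [← hm]
    exact_mod_cast card_incident_le H x
  have hcard : (#S : ℤ) + #T ≤ Fintype.card W := by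
    rw [← Nat.cast_add, ← Finset.card_union_of_disjoint hST]
    exact_mod_cast Finset.card_le_univ _
  have hmain := cut_arith hA hB (Nat.cast_nonneg m) (Nat.cast_nonneg _) (Nat.cast_nonneg _)
    hcard hl hlt hN
  have hg : ∑ x ∈ T, g x ≤ B * #T := by
    rw [mul_comm, ← nsmul_eq_mul]
    exact Finset.sum_le_card_nsmul _ _ _ fun x _ => hgB x
  have hf : A * #S ≤ ∑ x ∈ S, f x := by
    rw [mul_comm, ← nsmul_eq_mul]
    exact Finset.card_nsmul_le_sum _ _ _ fun x _ => hfA x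
  have hfinal : ∑ x ∈ T, g x ≤ ∑ x ∈ S, f x +
      ∑ x ∈ T, (#{v | v ∉ S ∧ ((⊤ : SimpleGraph W).deleteEdges ↑H).Adj x v} : ℤ) := by
    linarith
  have hreal : ∑ x ∈ T, (g x : ℝ) ≤ ∑ x ∈ S, (f x : ℝ) +
      ∑ x ∈ T, (#{v | v ∉ S ∧ ((⊤ : SimpleGraph W).deleteEdges ↑H).Adj x v} : ℝ) := by
    exact_mod_cast hfinal
  convert hreal

theorem statement_7 {V : Type*} [Fintype V] [DecidableEq V]
    (a b n' m Δ : ℕ) (g f : V → ℤ)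
    (hba : a + Δ ≤ b) (ha : 2 ≤ a)
    (hn : (Fintype.card V : ℝ) >
      ((a : ℝ) + b) * ((a : ℝ) + b + 2 * m - 2) / ((a : ℝ) + Δ) + n')
    (hgf : ∀ x : V, (a : ℤ) ≤ g x ∧ g x ≤ f x - (Δ : ℤ) ∧ f x - (Δ : ℤ) ≤ (b : ℤ) - (Δ : ℤ)) :
    FracCriticalDeleted (⊤ : SimpleGraph V) g f n' m := by
  intro U hU
  have hcard : Fintype.card V = Fintype.card ↥((↑U : Set V)ᶜ) + n' := by
    have h := Fintype.card_compl_set (↑U : Set V)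
    have hle : #U ≤ Fintype.card V := Finset.card_le_univ U
    rw [show Fintype.card ↑(↑U : Set V) = #U from Fintype.card_coe U] at h
    omega
  rw [SimpleGraph.induce_top]
  refine fracDeleted_top (A := a + Δ) (B := b - Δ) (by omega) (by omega) (fun x => ?_)
    (fun x => ?_) (fun x => ?_) ?_
  · have := hgf x
    omega
  · have := hgf x
    omega
  · have := hgf x
    omega
  · have ha' : (0 : ℝ) < a + Δ := by positivity
    rw [hcard, Nat.cast_add, gt_iff_lt, add_lt_add_iff_right, div_lt_iff₀ ha'] at hn
    have hn' : ((a : ℤ) + b) * (a + b + 2 * m - 2) <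
        (Fintype.card ↥((↑U : Set V)ᶜ) : ℤ) * (a + Δ) := by exact_mod_cast hn
    calc _ = ((a : ℤ) + b) * (a + b + 2 * m - 2) := by ring
      _ < _ := hn'
      _ = _ := mul_comm _ _
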